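/- Let (R,𝔪) be a Cohen-Macaulay local ring with canonical module that is generically Gorenstein and not Gorenstein, let ω be a canonical ideal of R, let x ∈ ω be an R-regular element, and set (ω/xR)^∨ := Ext^1_R(ω/xR, ω). Then γ_R(Ω^1_R(ω/xR)) = 0 and γ_R(Ω^1_R((ω/xR)^∨)) = 0, where Ω^1_R(M) is the first syzygy of M in a minimal free resolution and γ_R is the canonical-rank invariant. -/

import Mathlib

open CategoryTheory

noncomputable section

/-- The Ext module `Ext^n_R(M, N)` for `R`-modules `M`, `N`. -/
abbrev ModExt (R : Type) [CommRing R] (n : ℕ) (M N : ModuleCat R) : ModuleCat R :=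
  ((Ext R (ModuleCat R) n).obj (Opposite.op M)).obj N

/-- An `R`-module `M` has finite injective dimension if `Ext^i_R(-, M)` vanishes
for all `i` beyond some bound. -/
def HasFiniteInjDim (R : Type) [CommRing R] (M : ModuleCat R) : Prop :=
  ∃ n : ℕ, ∀ (N : ModuleCat R) (i : ℕ), n < i → Subsingleton (ModExt R i N M)

/-- The depth of a module over a local ring, via Rees' characterization:
the least `n` with `Ext^n(k, M) ≠ 0`. -/
def moduleDepth (R : Type) [CommRing R] [IsLocalRing R] (M : ModuleCat R) : ℕ∞ :=
  sInf {n : ℕ∞ | ∃ m : ℕ, n = (m : ℕ∞) ∧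
    Nontrivial (ModExt R m (ModuleCat.of R (IsLocalRing.ResidueField R)) M)}

/-- A Noetherian local ring is Cohen-Macaulay if its depth equals its Krull dimension. -/
def IsCMLocalRing (R : Type) [CommRing R] [IsLocalRing R] : Prop :=
  IsNoetherianRing R ∧
    (moduleDepth R (ModuleCat.of R R) : WithBot ℕ∞) = ringKrullDim R

/-- A maximal Cohen-Macaulay module: finitely generated with depth equal to `dim R`. -/
def IsMCM (R : Type) [CommRing R] [IsLocalRing R] (X : ModuleCat R) : Prop :=
  Module.Finite R X ∧ (moduleDepth R X : WithBot ℕ∞) = ringKrullDim R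

/-- A Cohen-Macaulay module of codimension one:
`depth M = dim M = dim R - 1`. -/
def IsCMofCodimOne (R : Type) [CommRing R] [IsLocalRing R] (M : ModuleCat R) : Prop :=
  Module.Finite R M ∧ ∃ d : ℕ, ringKrullDim R = ((d + 1 : ℕ) : WithBot ℕ∞) ∧
    moduleDepth R M = (d : ℕ∞) ∧
    ringKrullDim (R ⧸ Module.annihilator R M) = ((d : ℕ) : WithBot ℕ∞)

/-- A Gorenstein local ring: Noetherian local with finite injective dimension over itself. -/
def IsGorensteinLocalRing (A : Type) [CommRing A] : Prop :=
  IsNoetherianRing A ∧ IsLocalRing A ∧ HasFiniteInjDim A (ModuleCat.of A A)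

/-- `R` is generically Gorenstein if its localization at every minimal prime is Gorenstein. -/
def IsGenericallyGorenstein (R : Type) [CommRing R] : Prop :=
  ∀ p ∈ minimalPrimes R, ∀ h : p.IsPrime,
    letI := h
    IsGorensteinLocalRing (Localization.AtPrime p)

/-- A canonical module of a local ring `R`: finitely generated, of finite injective
dimension, with `Ext^i(k, ω) ≅ k` for `i = dim R` and `Ext^i(k, ω) = 0` otherwise. -/
def IsCanonicalModule (R : Type) [CommRing R] [IsLocalRing R] (W : ModuleCat R) : Prop :=
  Module.Finite R W ∧ HasFiniteInjDim R W ∧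
    ∃ d : ℕ, ringKrullDim R = (d : ℕ) ∧
      Nonempty ((ModExt R d (ModuleCat.of R (IsLocalRing.ResidueField R)) W) ≃ₗ[R]
        IsLocalRing.ResidueField R) ∧
      ∀ i : ℕ, i ≠ d →
        Subsingleton (ModExt R i (ModuleCat.of R (IsLocalRing.ResidueField R)) W)

/-- A canonical ideal: an ideal of `R` which, as an `R`-module, is a canonical module. -/
def IsCanonicalIdeal (R : Type) [CommRing R] [IsLocalRing R] (I : Ideal R) : Prop :=
  IsCanonicalModule R (ModuleCat.of R I)

/-- `Y` and `X` have a common nonzero direct summand via the map `ι : Y → X`. -/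
def HasCommonSummandVia (R : Type) [CommRing R] {Y X : ModuleCat R}
    (ι : Y →ₗ[R] X) : Prop :=
  ∃ (N Y' X' : ModuleCat.{0} R), Nontrivial N ∧
    ∃ (e : Y ≃ₗ[R] N × Y') (f : X ≃ₗ[R] N × X') (ι' : Y' →ₗ[R] X'),
      ∀ y : Y, f (ι y) = ((e y).1, ι' (e y).2)

/-- `0 → Y → X → M → 0` is an MCM approximation of `M`. -/
def IsMCMApprox (R : Type) [CommRing R] [IsLocalRing R] (M Y X : ModuleCat R)
    (ι : Y →ₗ[R] X) (π : X →ₗ[R] M) : Prop :=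
  Module.Finite R M ∧ Module.Finite R Y ∧ IsMCM R X ∧ HasFiniteInjDim R Y ∧
    Function.Injective ι ∧ Function.Surjective π ∧ Function.Exact ι π

/-- `0 → Y → X → M → 0` is a minimal MCM approximation of `M`. -/
def IsMinMCMApprox (R : Type) [CommRing R] [IsLocalRing R] (M Y X : ModuleCat R)
    (ι : Y →ₗ[R] X) (π : X →ₗ[R] M) : Prop :=
  IsMCMApprox R M Y X ι π ∧ ¬ HasCommonSummandVia R ι

/-- `0 → M → Y → X → 0` is an FID hull of `M`. -/
def IsFIDHull (R : Type) [CommRing R] [IsLocalRing R] (M Y X : ModuleCat R)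
    (ι : M →ₗ[R] Y) (π : Y →ₗ[R] X) : Prop :=
  Module.Finite R M ∧ Module.Finite R Y ∧ HasFiniteInjDim R Y ∧
    (IsMCM R X ∨ Subsingleton X) ∧
    Function.Injective ι ∧ Function.Surjective π ∧ Function.Exact ι π

/-- `0 → M → Y → X → 0` is a minimal FID hull of `M`. -/
def IsMinFIDHull (R : Type) [CommRing R] [IsLocalRing R] (M Y X : ModuleCat R)
    (ι : M →ₗ[R] Y) (π : Y →ₗ[R] X) : Prop :=
  IsFIDHull R M Y X ι π ∧ ¬ HasCommonSummandVia R π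

/-- The free rank of a module: the largest `m` with `R^m` a direct summand. -/
def freeRank (R : Type) [CommRing R] (X : ModuleCat R) : ℕ∞ :=
  sSup {n : ℕ∞ | ∃ m : ℕ, n = (m : ℕ∞) ∧
    ∃ X' : ModuleCat.{0} R, Nonempty (X ≃ₗ[R] ((Fin m → R) × X'))}

/-- The `W`-rank of a module: the largest `m` with `W^m` a direct summand. -/
def wRank (R : Type) [CommRing R] (W X : ModuleCat R) : ℕ∞ :=
  sSup {n : ℕ∞ | ∃ m : ℕ, n = (m : ℕ∞) ∧
    ∃ X' : ModuleCat.{0} R, Nonempty (X ≃ₗ[R] ((Fin m → W) × X'))}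

/-- `M` and `N` are `W`-stably isomorphic. -/
def WStablyIso (R : Type) [CommRing R] (W M N : ModuleCat R) : Prop :=
  ∃ s t : ℕ, Nonempty ((M × (Fin s → W)) ≃ₗ[R] (N × (Fin t → W)))

/-- The quotient module `I/J` (realized as `I` modulo the elements of `J` lying in `I`). -/
abbrev qmod (R : Type) [CommRing R] (I J : Ideal R) : ModuleCat R :=
  ModuleCat.of R (I ⧸ (Submodule.comap I.subtype J))

section Auxiliary

variable {R : Type} [CommRing R]

section Comparison

variable {M : ModuleCat.{0} R} (P : ProjectiveResolution M) (N : ModuleCat.{0} R)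

/-- The `n`-cocycles of the complex `Hom(P, N)`. -/
abbrev resolutionCocycles (n : ℕ) : Submodule R (P.complex.X n ⟶ N) :=
  LinearMap.ker (Linear.leftComp R N (P.complex.d (n + 1) n))

/-- The map from `i`-cochains to `n`-cocycles of `Hom(P, N)` induced by the differential. -/
abbrev resolutionToCocycles (i n : ℕ) : (P.complex.X i ⟶ N) →ₗ[R] resolutionCocycles P N n :=
  (Linear.leftComp R N (P.complex.d n i)).codRestrict _ fun f => by
    simp [resolutionCocycles]

theorem d_comp_resolutionCocycle {n : ℕ} (f : resolutionCocycles P N n) :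
    P.complex.d (n + 1) n ≫ f.1 = 0 := f.2

/-- The class in `Ext` of a cocycle, as a linear map. -/
def extMkLinear (n : ℕ) : resolutionCocycles P N n →ₗ[R] Abelian.Ext M N n where
  toFun f := P.extMk f.1 (n + 1) rfl (d_comp_resolutionCocycle P N f)
  map_add' f g := by
    rw [P.add_extMk]
    rfl
  map_smul' r f := by
    rw [RingHom.id_apply, Abelian.Ext.smul_eq_comp_mk₀, P.extMk_comp_mk₀]
    congr 1

theorem extMkLinear_surjective (n : ℕ) : Function.Surjective (extMkLinear P N n) := fun α =>
  let ⟨f, hf, h⟩ := P.extMk_surjective α (n + 1) rfl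
  ⟨⟨f, hf⟩, h⟩

theorem extMk_zero_eq_zero_iff (f : P.complex.X 0 ⟶ N) (hf : P.complex.d 1 0 ≫ f = 0) :
    P.extMk f 1 rfl hf = 0 ↔ f = 0 := by
  refine ⟨fun h => ?_, fun h => by subst h; simp⟩
  rw [← P.extEquivCohomologyClass.apply_eq_iff_eq, P.extEquivCohomologyClass_extMk,
    P.extEquivCohomologyClass_zero,
    CochainComplex.HomComplex.CohomologyClass.mk_eq_zero_iff,
    CochainComplex.HomComplex.Cocycle.toSingleMk_mem_coboundaries_iff _ _ _ _ _ 1 (by simp)] at h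
  obtain ⟨g, hg⟩ := h
  have h0 : Limits.IsZero (P.cochainComplex.X 1) :=
    CochainComplex.isZero_of_isStrictlyLE _ 0 _
  rw [h0.eq_of_src g 0, Limits.comp_zero] at hg
  rw [← cancel_epi (P.cochainComplexXIso (-(0 : ℕ)) 0 rfl).hom, ← hg, Limits.comp_zero]

theorem ker_extMkLinear (n : ℕ) :
    LinearMap.ker (extMkLinear P N n) =
      LinearMap.range (resolutionToCocycles P N ((ComplexShape.up ℕ).prev n) n) := by
  ext f
  rw [LinearMap.mem_ker, LinearMap.mem_range]
  change P.extMk f.1 (n + 1) rfl (d_comp_resolutionCocycle P N f) = 0 ↔ _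
  cases n with
  | zero =>
    rw [extMk_zero_eq_zero_iff]
    constructor
    · intro h
      exact ⟨0, by ext1; simp [h]⟩
    · rintro ⟨g, rfl⟩
      simp
  | succ n =>
    rw [P.extMk_eq_zero_iff _ _ _ _ n rfl]
    simp only [Subtype.ext_iff]
    rw [CochainComplex.prev_nat_succ]
    rfl

/-- The two constructions of `Ext` in `ModuleCat R` agree linearly. -/
def modExtEquiv (n : ℕ) (M N : ModuleCat.{0} R) : ModExt R n M N ≃ₗ[R] Abelian.Ext M N n :=
  let P := projectiveResolution M
  let e : ModExt R n M N ≃ₗ[R] (resolutionCocycles P N n ⧸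
      LinearMap.range (resolutionToCocycles P N ((ComplexShape.up ℕ).prev n) n)) :=
    (P.isoExt n N ≪≫ (P.complex.linearYonedaObj R N).homologyIsoSc'
      ((ComplexShape.up ℕ).prev n) n (n + 1) rfl (by simp) ≪≫
      ShortComplex.moduleCatHomologyIso _).toLinearEquiv
  e.trans ((Submodule.quotEquivOfEq _ _ (ker_extMkLinear P N n).symm).trans
    ((extMkLinear P N n).quotKerEquivOfSurjective (extMkLinear_surjective P N n)))

end Comparison

section Vanishing

variable (R) in
/-- Vanishing of `Ext^n_R(M, N)`. -/
abbrev ExtVanishes (n : ℕ) (M N : Type) [AddCommGroup M] [Module R M] [AddCommGroup N]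
    [Module R N] : Prop :=
  Subsingleton (Abelian.Ext (ModuleCat.of R M) (ModuleCat.of R N) n)

variable {A B C M N : Type} [AddCommGroup A] [Module R A] [AddCommGroup B] [Module R B]
  [AddCommGroup C] [Module R C] [AddCommGroup M] [Module R M] [AddCommGroup N] [Module R N]

/-- The short complex attached to an exact pair of linear maps. -/
abbrev exactComplex {f : A →ₗ[R] B} {g : B →ₗ[R] C} (h : Function.Exact f g) :
    ShortComplex (ModuleCat.{0} R) :=
  ModuleCat.shortComplexOfCompEqZero f g h.linearMap_comp_eq_zero

theorem exactComplex_shortExact {f : A →ₗ[R] B} {g : B →ₗ[R] C} (hf : Function.Injective f)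
    (hg : Function.Surjective g) (h : Function.Exact f g) : (exactComplex h).ShortExact :=
  ModuleCat.shortComplex_shortExact _ h hf hg

section LongExact

variable {f : A →ₗ[R] B} {g : B →ₗ[R] C} (hf : Function.Injective f)
  (hg : Function.Surjective g) (h : Function.Exact f g)

include hf hg h

theorem ExtVanishes.contra_left {n : ℕ} (h₂ : ExtVanishes R n B N)
    (h₃ : ExtVanishes R (n + 1) C N) : ExtVanishes R n A N := by
  refine subsingleton_of_forall_eq 0 fun a => ?_
  obtain ⟨b, rfl⟩ := Abelian.Ext.contravariant_sequence_exact₁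
    (exactComplex_shortExact hf hg h) (ModuleCat.of R N) a (add_comm 1 n) (h₃.elim _ _)
  rw [h₂.elim b 0, Abelian.Ext.comp_zero]

theorem ExtVanishes.contra_mid {n : ℕ} (h₁ : ExtVanishes R n A N)
    (h₃ : ExtVanishes R n C N) : ExtVanishes R n B N := by
  refine subsingleton_of_forall_eq 0 fun a => ?_
  obtain ⟨b, rfl⟩ := Abelian.Ext.contravariant_sequence_exact₂
    (exactComplex_shortExact hf hg h) (ModuleCat.of R N) a (h₁.elim _ _)
  rw [h₃.elim b 0, Abelian.Ext.comp_zero]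

theorem ExtVanishes.contra_right {n : ℕ} (h₁ : ExtVanishes R n A N)
    (h₂ : ExtVanishes R (n + 1) B N) : ExtVanishes R (n + 1) C N := by
  refine subsingleton_of_forall_eq 0 fun a => ?_
  obtain ⟨b, rfl⟩ := Abelian.Ext.contravariant_sequence_exact₃
    (exactComplex_shortExact hf hg h) (ModuleCat.of R N) a (h₂.elim _ _) (add_comm 1 n)
  rw [h₁.elim b 0, Abelian.Ext.comp_zero]

theorem ExtVanishes.contra_right_of_extends (hext : ∀ q : A →ₗ[R] N, ∃ Q : B →ₗ[R] N, Q ∘ₗ f = q)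
    (h₂ : ExtVanishes R 1 B N) : ExtVanishes R 1 C N := by
  refine subsingleton_of_forall_eq 0 fun a => ?_
  have hS := exactComplex_shortExact hf hg h
  obtain ⟨b, rfl⟩ := Abelian.Ext.contravariant_sequence_exact₃ hS
    (ModuleCat.of R N) a (h₂.elim _ _) (add_comm 1 0)
  obtain ⟨q, rfl⟩ := (Abelian.Ext.mk₀_bijective _ _).2 b
  obtain ⟨Q, hQ⟩ := hext q.hom
  have : q = ModuleCat.ofHom f ≫ ModuleCat.ofHom Q := by
    ext z
    exact (LinearMap.congr_fun hQ z).symm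
  rw [this, ← Abelian.Ext.mk₀_comp_mk₀]
  exact hS.extClass_comp_assoc _

theorem ExtVanishes.co_right {n : ℕ} (h₂ : ExtVanishes R n M B)
    (h₁ : ExtVanishes R (n + 1) M A) : ExtVanishes R n M C := by
  refine subsingleton_of_forall_eq 0 fun a => ?_
  obtain ⟨b, rfl⟩ := Abelian.Ext.covariant_sequence_exact₃ (ModuleCat.of R M)
    (exactComplex_shortExact hf hg h) a rfl (h₁.elim _ _)
  rw [h₂.elim b 0, Abelian.Ext.zero_comp]

/-- Maps out of the submodule extend when `Ext^1` of the quotient vanishes. -/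
theorem exists_extension (h₃ : ExtVanishes R 1 C N) (q : A →ₗ[R] N) :
    ∃ Q : B →ₗ[R] N, Q ∘ₗ f = q := by
  obtain ⟨b, hb⟩ := Abelian.Ext.contravariant_sequence_exact₁
    (exactComplex_shortExact hf hg h) (ModuleCat.of R N)
    (Abelian.Ext.mk₀ (ModuleCat.ofHom q)) (add_comm 1 0) (h₃.elim _ _)
  obtain ⟨Q, rfl⟩ := (Abelian.Ext.mk₀_bijective _ _).2 b
  rw [Abelian.Ext.mk₀_comp_mk₀] at hb
  refine ⟨Q.hom, ?_⟩
  simpa using congrArg ModuleCat.Hom.hom ((Abelian.Ext.mk₀_bijective _ _).1 hb)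

/-- Maps into the quotient lift when `Ext^1` into the submodule vanishes. -/
theorem exists_lift (h₁ : ExtVanishes R 1 M A) (q : M →ₗ[R] C) :
    ∃ Q : M →ₗ[R] B, g ∘ₗ Q = q := by
  obtain ⟨b, hb⟩ := Abelian.Ext.covariant_sequence_exact₃ (ModuleCat.of R M)
    (exactComplex_shortExact hf hg h) (Abelian.Ext.mk₀ (ModuleCat.ofHom q)) rfl (h₁.elim _ _)
  obtain ⟨Q, rfl⟩ := (Abelian.Ext.mk₀_bijective _ _).2 b
  rw [Abelian.Ext.mk₀_comp_mk₀] at hb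
  refine ⟨Q.hom, ?_⟩
  simpa using congrArg ModuleCat.Hom.hom ((Abelian.Ext.mk₀_bijective _ _).1 hb)

end LongExact

theorem ExtVanishes.congr_left (e : A ≃ₗ[R] B) {n : ℕ} (h : ExtVanishes R n A N) :
    ExtVanishes R n B N := by
  refine subsingleton_of_forall_eq 0 fun a => ?_
  have : (Abelian.Ext.mk₀ e.toModuleIso.inv).comp
      ((Abelian.Ext.mk₀ e.toModuleIso.hom).comp a (zero_add n)) (zero_add n) = a := by
    rw [Abelian.Ext.mk₀_comp_mk₀_assoc, Iso.inv_hom_id, Abelian.Ext.mk₀_id_comp]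
  rw [← this, h.elim (Abelian.Ext.comp _ a _) 0, Abelian.Ext.comp_zero]

theorem ExtVanishes.congr_right (e : A ≃ₗ[R] B) {n : ℕ} (h : ExtVanishes R n N A) :
    ExtVanishes R n N B := by
  refine subsingleton_of_forall_eq 0 fun a => ?_
  have : (a.comp (Abelian.Ext.mk₀ e.toModuleIso.inv) (add_zero n)).comp
      (Abelian.Ext.mk₀ e.toModuleIso.hom) (add_zero n) = a := by
    rw [Abelian.Ext.comp_assoc_of_second_deg_zero, Abelian.Ext.mk₀_comp_mk₀, Iso.inv_hom_id,
      Abelian.Ext.comp_mk₀_id]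
  rw [← this, h.elim (Abelian.Ext.comp a _ _) 0, Abelian.Ext.zero_comp]

theorem ExtVanishes.of_free [Module.Free R M] (n : ℕ) : ExtVanishes R (n + 1) M N :=
  Abelian.Ext.subsingleton_of_projective _ _ _

theorem ExtVanishes.of_subsingleton_left [Subsingleton M] (n : ℕ) : ExtVanishes R n M N := by
  refine subsingleton_of_forall_eq 0 fun a => ?_
  have : 𝟙 (ModuleCat.of R M) = 0 := by ext x; exact Subsingleton.elim (α := M) _ _
  rw [← a.mk₀_id_comp, this, Abelian.Ext.mk₀_zero, Abelian.Ext.zero_comp]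

theorem extVanishes_zero_iff : ExtVanishes R 0 M N ↔ Subsingleton (M →ₗ[R] N) :=
  (Abelian.Ext.homEquiv₀.trans ModuleCat.homEquiv).subsingleton_congr

theorem ExtVanishes.zero_of_surjective {g : B →ₗ[R] C} (hg : Function.Surjective g)
    (h : ExtVanishes R 0 B N) : ExtVanishes R 0 C N := by
  rw [extVanishes_zero_iff] at h ⊢
  exact ⟨fun u v => (LinearMap.cancel_right hg).1 (h.elim _ _)⟩

theorem extVanishes_iff_modExt (n : ℕ) (M N : ModuleCat.{0} R) :
    ExtVanishes R n M N ↔ Subsingleton (ModExt R n M N) :=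
  (modExtEquiv n M N).toEquiv.subsingleton_congr.symm

end Vanishing

section SMul

open scoped Pointwise

variable {A M N : Type} [AddCommGroup A] [Module R A] [AddCommGroup M] [Module R M]
  [AddCommGroup N] [Module R N]

theorem lsmul_injective {y : R} (h : IsSMulRegular N y) :
    Function.Injective (LinearMap.lsmul R N y) := h

theorem exact_lsmul_mkQ (y : R) :
    Function.Exact (LinearMap.lsmul R N y) (Submodule.mkQ (y • (⊤ : Submodule R N))) := by
  intro z
  rw [Submodule.mkQ_apply, Submodule.Quotient.mk_eq_zero, Submodule.mem_smul_pointwise_iff_exists]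
  simp

theorem mk₀_lsmul_comp (y : R) {n : ℕ}
    (a : Abelian.Ext (ModuleCat.of R M) (ModuleCat.of R N) n) :
    (Abelian.Ext.mk₀ (ModuleCat.ofHom (LinearMap.lsmul R M y))).comp a (zero_add n) = y • a := by
  have : ModuleCat.ofHom (LinearMap.lsmul R M y) = y • 𝟙 (ModuleCat.of R M) := by ext; rfl
  rw [this, Abelian.Ext.mk₀_smul, Abelian.Ext.smul_comp, Abelian.Ext.mk₀_id_comp]

theorem comp_mk₀_lsmul (y : R) {n : ℕ}
    (a : Abelian.Ext (ModuleCat.of R M) (ModuleCat.of R N) n) :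
    a.comp (Abelian.Ext.mk₀ (ModuleCat.ofHom (LinearMap.lsmul R N y))) (add_zero n) = y • a := by
  have : ModuleCat.ofHom (LinearMap.lsmul R N y) = y • 𝟙 (ModuleCat.of R N) := by ext; rfl
  rw [this, Abelian.Ext.mk₀_smul, Abelian.Ext.comp_smul, Abelian.Ext.comp_mk₀_id]

theorem smul_ext_eq_zero {y : R} (hy : y ∈ Module.annihilator R M) {n : ℕ}
    (a : Abelian.Ext (ModuleCat.of R M) (ModuleCat.of R N) n) : y • a = 0 := by
  have : ModuleCat.ofHom (LinearMap.lsmul R M y) = 0 := by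
    ext z
    exact Module.mem_annihilator.1 hy z
  rw [← mk₀_lsmul_comp, this, Abelian.Ext.mk₀_zero, Abelian.Ext.zero_comp]

/-- If an `N`-regular element kills `M`, vanishing of `Ext^n(M, N/yN)` implies that of
`Ext^{n+1}(M, N)`. -/
theorem ExtVanishes.of_quotSMulTop_right {y : R} (hy : y ∈ Module.annihilator R M)
    (hreg : IsSMulRegular N y) {n : ℕ} (h : ExtVanishes R n M (QuotSMulTop y N)) :
    ExtVanishes R (n + 1) M N := by
  refine subsingleton_of_forall_eq 0 fun a => ?_
  obtain ⟨b, rfl⟩ := Abelian.Ext.covariant_sequence_exact₁ (ModuleCat.of R M)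
    (exactComplex_shortExact (lsmul_injective hreg) (Submodule.mkQ_surjective _) (exact_lsmul_mkQ y)) a
    ((comp_mk₀_lsmul y a).trans (smul_ext_eq_zero hy a)) rfl
  rw [h.elim b 0, Abelian.Ext.zero_comp]

/-- If `Ext^1(M, N)` vanishes, the functor `Hom(M, -)` commutes with
reduction modulo an `N`-regular element. -/
theorem nonempty_quotSMulTop_hom_equiv {y : R} (hreg : IsSMulRegular N y)
    (h : ExtVanishes R 1 M N) :
    Nonempty (QuotSMulTop y (M →ₗ[R] N) ≃ₗ[R] (M →ₗ[R] QuotSMulTop y N)) := by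
  let F : (M →ₗ[R] N) →ₗ[R] (M →ₗ[R] QuotSMulTop y N) :=
    (Submodule.mkQ (y • (⊤ : Submodule R N))).compRight R
  have hF : Function.Surjective F :=
    exists_lift (lsmul_injective hreg) (Submodule.mkQ_surjective _) (exact_lsmul_mkQ y) h
  have hker : y • (⊤ : Submodule R (M →ₗ[R] N)) = LinearMap.ker F := by
    ext f
    rw [Submodule.mem_smul_pointwise_iff_exists, LinearMap.mem_ker]
    constructor
    · rintro ⟨g, -, rfl⟩
      ext z
      exact (exact_lsmul_mkQ y (y • g z)).2 ⟨g z, rfl⟩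
    · intro hf
      have hz (z : M) : ∃ w : N, y • w = f z :=
        (exact_lsmul_mkQ y (f z)).1 (LinearMap.congr_fun hf z)
      choose g hg using hz
      refine ⟨⟨⟨g, fun a b => hreg ?_⟩, fun r a => hreg ?_⟩, trivial, ?_⟩
      · simp [hg]
      · simp [hg, smul_comm y r]
      · ext z
        exact hg z
  exact ⟨(Submodule.quotEquivOfEq _ _ hker).trans (F.quotKerEquivOfSurjective hF)⟩

theorem isWeaklyRegular_linearMap (rs : List R) :
    ∀ (N : Type) [AddCommGroup N] [Module R N], RingTheory.Sequence.IsWeaklyRegular N rs →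
      (∀ i, ExtVanishes R (i + 1) M N) →
      RingTheory.Sequence.IsWeaklyRegular (M →ₗ[R] N) rs := by
  induction rs with
  | nil => intros; exact .nil R _
  | cons y rs ih =>
    intro N _ _ hN h
    rw [RingTheory.Sequence.isWeaklyRegular_cons_iff] at hN ⊢
    refine ⟨fun f g hfg => LinearMap.ext fun z => hN.1 (LinearMap.congr_fun hfg z), ?_⟩
    obtain ⟨e⟩ := nonempty_quotSMulTop_hom_equiv hN.1 (h 0)
    rw [LinearEquiv.isWeaklyRegular_congr e]
    exact ih _ hN.2 fun i => (h i).co_right (lsmul_injective hN.1) (Submodule.mkQ_surjective _)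
      (exact_lsmul_mkQ y) (h (i + 1))

end SMul

section Local

open IsLocalRing

variable [IsNoetherianRing R] [IsLocalRing R]

variable (R) in
/-- Vanishing of `Ext^n_R(-, Y)` on finitely generated modules. -/
abbrev ExtVanishesOnFinite (n : ℕ) (Y : Type) [AddCommGroup Y] [Module R Y] : Prop :=
  ∀ (L : Type) [AddCommGroup L] [Module R L] [Module.Finite R L], ExtVanishes R n L Y

variable {N Y : Type} [AddCommGroup N] [Module R N] [Module.Finite R N]
  [AddCommGroup Y] [Module R Y] [Module.Finite R Y]

omit [IsNoetherianRing R] in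
theorem subsingleton_of_forall_exists_smul {E : Type} [AddCommGroup E] [Module R E]
    [Module.Finite R E] {y : R} (hy : y ∈ maximalIdeal R) (h : ∀ a : E, ∃ b : E, y • b = a) :
    Subsingleton E := by
  rw [← Submodule.subsingleton_iff R]
  refine subsingleton_of_bot_eq_top (Eq.symm ?_)
  refine Submodule.eq_bot_of_le_smul_of_le_jacobson_bot (maximalIdeal R) ⊤ Module.Finite.fg_top
    (fun a _ => ?_) (IsLocalRing.maximalIdeal_le_jacobson _)
  obtain ⟨b, rfl⟩ := h a
  exact Submodule.smul_mem_smul hy trivial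

theorem ExtVanishes.of_quotSMulTop_left {y : R} (hy : y ∈ maximalIdeal R)
    (hreg : IsSMulRegular N y) {n : ℕ} (h : ExtVanishes R (n + 1) (QuotSMulTop y N) Y) :
    ExtVanishes R n N Y := by
  have := ModuleCat.finite_ext R (ModuleCat.of R N) (ModuleCat.of R Y) n
  refine subsingleton_of_forall_exists_smul hy fun a => ?_
  obtain ⟨b, hb⟩ := Abelian.Ext.contravariant_sequence_exact₁
    (exactComplex_shortExact (lsmul_injective hreg) (Submodule.mkQ_surjective _) (exact_lsmul_mkQ y))
    (ModuleCat.of R Y) a (add_comm 1 n) (h.elim _ _)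
  exact ⟨b, (mk₀_lsmul_comp y b).symm.trans hb⟩

theorem extVanishes_of_isWeaklyRegular {d : ℕ} (hY : ∀ m, d < m → ExtVanishesOnFinite R m Y)
    (rs : List R) : ∀ (N : Type) [AddCommGroup N] [Module R N] [Module.Finite R N] (n : ℕ),
      (∀ r ∈ rs, r ∈ maximalIdeal R) → RingTheory.Sequence.IsWeaklyRegular N rs →
      d < n + rs.length → ExtVanishes R n N Y := by
  induction rs with
  | nil => intro N _ _ _ n _ _ hn; exact hY n hn N
  | cons y rs ih =>
    intro N _ _ _ n hrs hN hn
    rw [RingTheory.Sequence.isWeaklyRegular_cons_iff] at hN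
    refine ExtVanishes.of_quotSMulTop_left (hrs y (by simp)) hN.1 (ih _ (n + 1)
      (fun r hr => hrs r (by simp [hr])) hN.2 ?_)
    simp only [List.length_cons] at hn
    omega

theorem ExtVanishesOnFinite.of_residueField {n : ℕ} (hsucc : ExtVanishesOnFinite R (n + 1) Y)
    (hk : ExtVanishes R n (ResidueField R) Y) : ExtVanishesOnFinite R n Y := by
  intro L _ _ hL
  refine IsNoetherianRing.induction_on_isQuotientEquivQuotientPrime R hL
    (motive := fun L _ _ _ => ExtVanishes R n L Y) ?_ ?_ ?_
  · intro N _ _ _ _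
    exact .of_subsingleton_left n
  · intro N _ _ _ p e
    refine ExtVanishes.congr_left e.symm ?_
    by_cases hp : p.asIdeal = maximalIdeal R
    · exact hk.congr_left (Submodule.quotEquivOfEq _ _ hp).symm
    · obtain ⟨y, hy, hyp⟩ := SetLike.not_le_iff_exists.1 fun h =>
        hp (le_antisymm (le_maximalIdeal p.2.ne_top) h)
      refine ExtVanishes.of_quotSMulTop_left hy (fun a b hab => ?_) (hsucc _)
      have hy0 : Ideal.Quotient.mk p.asIdeal y ≠ 0 := by
        rwa [Ne, Ideal.Quotient.eq_zero_iff_mem]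
      have : Ideal.Quotient.mk p.asIdeal y * a = Ideal.Quotient.mk p.asIdeal y * b := by
        simpa [Algebra.smul_def] using hab
      exact mul_left_cancel₀ hy0 this
  · intro N₁ _ _ _ N₂ _ _ _ N₃ _ _ _ f g hf hg h h₁ h₃
    exact h₁.contra_mid hf hg h h₃

omit [IsNoetherianRing R] in
theorem annihilator_residueField : Module.annihilator R (ResidueField R) = maximalIdeal R :=
  Ideal.annihilator_quotient

omit [IsNoetherianRing R] in
theorem exists_injective_of_not_extVanishes_zero {A : Type} [AddCommGroup A] [Module R A]
    (h : ¬ ExtVanishes R 0 (ResidueField R) A) :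
    ∃ f : ResidueField R →ₗ[R] A, Function.Injective f := by
  rw [extVanishes_zero_iff, not_subsingleton_iff_nontrivial] at h
  obtain ⟨f, hf⟩ := exists_ne (0 : ResidueField R →ₗ[R] A)
  have : IsSimpleModule R (ResidueField R) :=
    isSimpleModule_iff_quot_maximal.2 ⟨_, maximalIdeal.isMaximal R, ⟨.refl R _⟩⟩
  exact ⟨f, LinearMap.injective_of_ne_zero hf⟩

theorem exists_regular_of_extVanishes_zero {A : Type} [AddCommGroup A] [Module R A]
    [Module.Finite R A] (h : ExtVanishes R 0 (ResidueField R) A) :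
    ∃ y ∈ maximalIdeal R, IsSMulRegular A y := by
  rw [extVanishes_zero_iff, IsSMulRegular.subsingleton_linearMap_iff,
    annihilator_residueField] at h
  exact h

omit [Module.Finite R Y] in
/-- If `A` has depth `r` and `Ext^n(A, Y) = 0` for `n > s`, then `Ext^n(k, Y)` vanishes
for `n > r + s` as soon as `Ext^{n+1}(-, Y)` does. -/
theorem extVanishes_residueField_of_depth (r : ℕ) :
    ∀ (A : Type) [AddCommGroup A] [Module R A] [Module.Finite R A] (s : ℕ),
      (∀ i < r, ExtVanishes R i (ResidueField R) A) → ¬ ExtVanishes R r (ResidueField R) A →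
      (∀ n, s < n → ExtVanishes R n A Y) → ∀ n, r + s < n → ExtVanishesOnFinite R (n + 1) Y →
      ExtVanishes R n (ResidueField R) Y := by
  induction r with
  | zero =>
    intro A _ _ _ s _ h0 hA n hn hsucc
    obtain ⟨f, hf⟩ := exists_injective_of_not_extVanishes_zero h0
    exact (hA n (by omega)).contra_left hf (Submodule.mkQ_surjective _)
      (LinearMap.exact_map_mkQ_range f) (hsucc _)
  | succ r ih =>
    intro A _ _ _ s hlt hr hA n hn hsucc
    obtain ⟨y, hy, hreg⟩ := exists_regular_of_extVanishes_zero (hlt 0 (by omega))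
    refine ih (QuotSMulTop y A) (s + 1) (fun i hi => ?_) (fun h => hr ?_) (fun m hm => ?_) n
      (by omega) hsucc
    · exact (hlt i (by omega)).co_right (lsmul_injective hreg) (Submodule.mkQ_surjective _) (exact_lsmul_mkQ y)
        (hlt (i + 1) (by omega))
    · exact h.of_quotSMulTop_right (by rwa [annihilator_residueField]) hreg
    · obtain ⟨m, rfl⟩ : ∃ m', m = m' + 1 := ⟨m - 1, by omega⟩
      exact (hA m (by omega)).contra_right (lsmul_injective hreg) (Submodule.mkQ_surjective _) (exact_lsmul_mkQ y)
        (hA (m + 1) (by omega))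

/-- Bass: the injective dimension of a finite module of finite injective dimension is at most
the depth of the ring. -/
theorem extVanishesOnFinite_of_depth {d : ℕ} (hlt : ∀ i < d, ExtVanishes R i (ResidueField R) R)
    (hd : ¬ ExtVanishes R d (ResidueField R) R) {b : ℕ}
    (hb : ∀ n, b < n → ExtVanishesOnFinite R n Y) (n : ℕ) (hn : d < n) :
    ExtVanishesOnFinite R n Y := by
  by_cases h : b < n
  · exact hb n h
  · have hsucc := extVanishesOnFinite_of_depth hlt hd hb (n + 1) (by omega)
    refine .of_residueField hsucc (extVanishes_residueField_of_depth d R 0 hlt hd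
      (fun m hm => ?_) n hn hsucc)
    obtain ⟨m, rfl⟩ : ∃ m', m = m' + 1 := ⟨m - 1, by omega⟩
    exact .of_free m
termination_by b + 1 - n

end Local

section Canonical

open IsLocalRing

open scoped Pointwise

variable [IsNoetherianRing R] [IsLocalRing R]

/-- A finite module all of whose `Ext` modules into a canonical-like module vanish is zero. -/
theorem subsingleton_of_extVanishes {C W : Type} [AddCommGroup C] [Module R C]
    [Module.Finite R C] [AddCommGroup W] [Module R W] {d : ℕ}
    (hd : ¬ ExtVanishes R d (ResidueField R) W) (hW : ExtVanishesOnFinite R (d + 1) W)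
    (hC : ∀ i, ExtVanishes R i C W) : Subsingleton C := by
  suffices H : ∀ K : Submodule R C, (∀ i, ExtVanishes R i (C ⧸ K) W) → K = ⊤ by
    have h := H ⊥ fun i => (hC i).congr_left (Submodule.quotEquivOfEqBot ⊥ rfl).symm
    rw [← Submodule.subsingleton_iff R]
    exact subsingleton_of_bot_eq_top h
  intro K
  induction K using IsNoetherian.induction with | hgt K ih => ?_
  intro hK
  by_cases h0 : ExtVanishes R 0 (ResidueField R) (C ⧸ K)
  · obtain ⟨y, hy, hreg⟩ := exists_regular_of_extVanishes_zero h0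
    let g : C →ₗ[R] QuotSMulTop y (C ⧸ K) := Submodule.mkQ _ ∘ₗ K.mkQ
    have hg : Function.Surjective g :=
      (Submodule.mkQ_surjective _).comp (Submodule.mkQ_surjective _)
    have hKg : K ≤ LinearMap.ker g := fun c hc => by
      have : K.mkQ c = 0 := (Submodule.Quotient.mk_eq_zero K).2 hc
      rw [LinearMap.mem_ker, LinearMap.comp_apply, this, map_zero]
    have hg' (c : C) (hc : g c = 0) : ∃ b, y • b = K.mkQ c :=
      (exact_lsmul_mkQ y (K.mkQ c)).1 hc
    suffices hs : Subsingleton (C ⧸ K) from Submodule.Quotient.subsingleton_iff.1 hs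
    rcases hKg.eq_or_lt with heq | hlt
    · refine ⟨fun a b => hreg ?_⟩
      have hzero (a : C ⧸ K) : y • a = 0 := by
        obtain ⟨a, rfl⟩ := K.mkQ_surjective a
        have hmem : y • a ∈ LinearMap.ker g :=
          (exact_lsmul_mkQ y (y • K.mkQ a)).2 ⟨K.mkQ a, rfl⟩
        rw [← heq] at hmem
        exact (Submodule.Quotient.mk_eq_zero K).2 hmem
      exact (hzero a).trans (hzero b).symm
    · have htop := ih _ hlt fun i => by
        refine ExtVanishes.congr_left (g.quotKerEquivOfSurjective hg).symm ?_
        cases i with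
        | zero => exact (hK 0).zero_of_surjective (Submodule.mkQ_surjective _)
        | succ i =>
          exact (hK i).contra_right (lsmul_injective hreg) (Submodule.mkQ_surjective _)
            (exact_lsmul_mkQ y) (hK (i + 1))
      refine subsingleton_of_forall_exists_smul hy fun a => ?_
      obtain ⟨a, rfl⟩ := K.mkQ_surjective a
      exact hg' a (LinearMap.mem_ker.1 (htop ▸ Submodule.mem_top))
  · obtain ⟨f, hf⟩ := exists_injective_of_not_extVanishes_zero h0
    exact absurd ((hK d).contra_left hf (Submodule.mkQ_surjective _)
      (LinearMap.exact_map_mkQ_range f) (hW _)) hd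

variable {ω : Ideal R} {x : R}

omit [IsNoetherianRing R] [IsLocalRing R] in
theorem smul_apply_comm_of_mem (hxω : x ∈ ω) {N : Type} [AddCommGroup N] [Module R N]
    (s : ω →ₗ[R] N) (w : ω) : (w : R) • s ⟨x, hxω⟩ = x • s w := by
  rw [← map_smul, ← map_smul]
  congr 1
  ext
  exact mul_comm _ _

/-- Every endomorphism of a canonical ideal is a homothety. -/
theorem exists_eq_smul_of_end (hxω : x ∈ ω) (hxreg : x ∈ nonZeroDivisors R) {d : ℕ}
    (hd : ¬ ExtVanishes R d (ResidueField R) ω) (hω : ExtVanishesOnFinite R (d + 1) ω)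
    (hEnd : ∀ i, ExtVanishes R (i + 1) (ω →ₗ[R] ω) ω) (s : ω →ₗ[R] ω) :
    ∃ r : R, s = r • LinearMap.id := by
  let j : R →ₗ[R] (ω →ₗ[R] ω) := LinearMap.toSpanSingleton R _ LinearMap.id
  have hj : Function.Injective j := by
    rw [injective_iff_map_eq_zero]
    intro r hr
    have : r * x = 0 := congrArg Subtype.val (LinearMap.congr_fun hr ⟨x, hxω⟩)
    exact (mul_right_mem_nonZeroDivisors_eq_zero_iff hxreg).1 this
  have hex := LinearMap.exact_map_mkQ_range j
  have hsurj := Submodule.mkQ_surjective (LinearMap.range j)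
  have hC : Subsingleton ((ω →ₗ[R] ω) ⧸ LinearMap.range j) := by
    refine subsingleton_of_extVanishes hd hω fun i => ?_
    match i with
    | 0 =>
      rw [extVanishes_zero_iff]
      refine subsingleton_of_forall_eq 0 fun h => ?_
      rw [← LinearMap.cancel_right hsurj]
      ext1 s
      have hid : h (Submodule.mkQ _ LinearMap.id) = 0 := by
        rw [(hex LinearMap.id).2 ⟨1, one_smul R _⟩, map_zero]
      have hs : x • s = (s ⟨x, hxω⟩ : R) • LinearMap.id := by
        ext w
        have := congrArg Subtype.val (smul_apply_comm_of_mem hxω s w)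
        simpa [mul_comm] using this.symm
      have hxs : x • h (Submodule.mkQ _ s) = 0 := by
        rw [← map_smul, ← map_smul, hs, map_smul, map_smul, hid, smul_zero]
      ext
      exact (mul_left_mem_nonZeroDivisors_eq_zero_iff hxreg).1 (congrArg Subtype.val hxs)
    | 1 =>
      refine ExtVanishes.contra_right_of_extends hj hsurj hex (fun q => ?_) (hEnd 0)
      refine ⟨LinearMap.applyₗ (q 1), ?_⟩
      ext
      simp [j]
    | i + 2 => exact (ExtVanishes.of_free i).contra_right hj hsurj hex (hEnd (i + 1))
  obtain ⟨r, hr⟩ := (hex s).1 (hC.elim _ _)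
  exact ⟨r, hr.symm⟩

end Canonical

section Retract

open IsLocalRing

variable {ω : Ideal R} {x : R}

/-- An ideal with a regular element that is a retract of a finite free module over a local ring
is isomorphic to the ring. -/
theorem nonempty_linearEquiv_of_retract [IsLocalRing R] [Module.Finite R ω] (hxω : x ∈ ω)
    (hxreg : x ∈ nonZeroDivisors R) {F : Type} [AddCommGroup F] [Module R F] [Module.Free R F]
    [Module.Finite R F] (u : ω →ₗ[R] F) (q : F →ₗ[R] ω) (hqu : q ∘ₗ u = LinearMap.id) :
    Nonempty (ω ≃ₗ[R] R) := by
  have hx0 : (⟨x, hxω⟩ : ω) ≠ 0 := fun h =>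
    nonZeroDivisors.ne_zero hxreg (congrArg Subtype.val h)
  obtain ⟨l, w, hw⟩ : ∃ (l : ω →ₗ[R] R) (w : ω), l w ∉ maximalIdeal R := by
    by_contra! hall
    have htop : (⊤ : Submodule R ω) ≤ maximalIdeal R • ⊤ := fun w _ => by
      have hw : w = q (u w) := (LinearMap.congr_fun hqu w).symm
      rw [hw, ← (Module.Free.chooseBasis R F).sum_repr (u w), map_sum]
      refine Submodule.sum_mem _ fun i _ => ?_
      rw [map_smul]
      exact Submodule.smul_mem_smul
        (hall ((Module.Free.chooseBasis R F).coord i ∘ₗ u) w) trivial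
    have hbot := Submodule.eq_bot_of_le_smul_of_le_jacobson_bot (maximalIdeal R) ⊤
      Module.Finite.fg_top htop (maximalIdeal_le_jacobson _)
    exact hx0 ((Submodule.mem_bot R).1 (hbot ▸ Submodule.mem_top))
  have hunit : IsUnit (l w) := by simpa using hw
  refine ⟨LinearEquiv.ofBijective l ⟨?_, fun r => ?_⟩⟩
  · rw [injective_iff_map_eq_zero]
    intro v hv
    have hlx : l ⟨x, hxω⟩ * v = 0 := by
      have := smul_apply_comm_of_mem hxω l v
      rwa [hv, smul_zero, smul_eq_mul, mul_comm] at this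
    have hxv : l w * (x * v) = 0 := by
      have := smul_apply_comm_of_mem hxω l w
      simp only [smul_eq_mul] at this
      rw [← mul_assoc, mul_comm (l w), ← this, mul_assoc, hlx, mul_zero]
    ext
    exact (mul_left_mem_nonZeroDivisors_eq_zero_iff hxreg).1 ((hunit.mul_right_eq_zero).1 hxv)
  · obtain ⟨t, ht⟩ := hunit
    exact ⟨(r * ↑t⁻¹ : R) • w, by simp [← ht]⟩

variable {E : Type} [AddCommGroup E] [Module R E] {g : ω →ₗ[R] E}

/-- If `ω` is a retract of a syzygy of `ω / xR`, it is a retract of a free module. -/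
theorem exists_free_retract (hxreg : x ∈ nonZeroDivisors R) (hxω : x ∈ ω)
    (hg : Function.Surjective g)
    (hex : Function.Exact (LinearMap.toSpanSingleton R ω ⟨x, hxω⟩) g)
    (hω : ExtVanishes R 1 ω ω) {n : ℕ} {p : (Fin n → R) →ₗ[R] E}
    (hp : Function.Surjective p) (i : ω →ₗ[R] LinearMap.ker p) (q : LinearMap.ker p →ₗ[R] ω)
    (hqi : q ∘ₗ i = LinearMap.id) :
    ∃ (u : ω →ₗ[R] (Fin n → R) × R) (q' : (Fin n → R) × R →ₗ[R] ω),
      q' ∘ₗ u = LinearMap.id := by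
  obtain ⟨G, hG⟩ := Module.projective_lifting_property g p hg
  have hG' (v : Fin n → R) : g (G v) = p v := LinearMap.congr_fun hG v
  let Φ := G.coprod (LinearMap.toSpanSingleton R ω ⟨x, hxω⟩)
  have hΦ : Function.Surjective Φ := fun w => by
    obtain ⟨v, hv⟩ := hp (g w)
    obtain ⟨r, hr⟩ := (hex (w - G v)).1 (by rw [map_sub, hG', hv, sub_self])
    exact ⟨(v, r), by rw [LinearMap.coprod_apply, hr, add_sub_cancel]⟩
  have hfst (z : LinearMap.ker Φ) : z.1.1 ∈ LinearMap.ker p := by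
    have h := LinearMap.mem_ker.1 z.2
    rw [LinearMap.coprod_apply] at h
    rw [LinearMap.mem_ker, ← hG', eq_neg_of_add_eq_zero_left h, map_neg,
      (hex _).2 ⟨_, rfl⟩, neg_zero]
  let e : LinearMap.ker Φ ≃ₗ[R] LinearMap.ker p :=
    LinearEquiv.ofBijective
      ((LinearMap.fst R (Fin n → R) R ∘ₗ (LinearMap.ker Φ).subtype).codRestrict _ hfst) <| by
    constructor
    · rw [injective_iff_map_eq_zero]
      intro z hz
      have hz1 : z.1.1 = 0 := congrArg Subtype.val hz
      have h := LinearMap.mem_ker.1 z.2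
      rw [LinearMap.coprod_apply, hz1, map_zero, zero_add] at h
      ext1
      exact Prod.ext hz1
        ((mul_right_mem_nonZeroDivisors_eq_zero_iff hxreg).1 (congrArg Subtype.val h))
    · intro v
      obtain ⟨r, hr⟩ := (hex (G v)).1 (by rw [hG', v.2])
      refine ⟨⟨(v, -r), ?_⟩, rfl⟩
      rw [LinearMap.mem_ker, LinearMap.coprod_apply, map_neg, hr, add_neg_cancel]
  obtain ⟨q', hq'⟩ := exists_extension (LinearMap.ker Φ).injective_subtype hΦ
    (LinearMap.exact_subtype_ker_map Φ) hω (q ∘ₗ e.toLinearMap)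
  refine ⟨(LinearMap.ker Φ).subtype ∘ₗ e.symm.toLinearMap ∘ₗ i, q', ?_⟩
  rw [← LinearMap.comp_assoc, hq', ← hqi]
  ext1 w
  simp

theorem exact_toSpanSingleton_mkQ (hxω : x ∈ ω) :
    Function.Exact (LinearMap.toSpanSingleton R ω ⟨x, hxω⟩)
      (Submodule.mkQ (Submodule.comap ω.subtype (Ideal.span {x}))) := by
  intro w
  rw [Submodule.mkQ_apply, Submodule.Quotient.mk_eq_zero, Submodule.mem_comap,
    Ideal.mem_span_singleton']
  exact exists_congr fun r => by rw [Subtype.ext_iff]; rfl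

theorem toSpanSingleton_injective (hxω : x ∈ ω) (hxreg : x ∈ nonZeroDivisors R) :
    Function.Injective (LinearMap.toSpanSingleton R ω ⟨x, hxω⟩) := by
  rw [injective_iff_map_eq_zero]
  intro r hr
  exact (mul_right_mem_nonZeroDivisors_eq_zero_iff hxreg).1 (congrArg Subtype.val hr)

/-- The codimension one Cohen-Macaulay module `ω / xR` is self-dual: its dual is again a quotient
of `ω` by `xR`. -/
theorem exists_surjective_ext_one (hxω : x ∈ ω) (hxreg : x ∈ nonZeroDivisors R)
    (hω : ExtVanishes R 1 ω ω) (hend : ∀ s : ω →ₗ[R] ω, ∃ r : R, s = r • LinearMap.id) :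
    ∃ g : ω →ₗ[R] ModExt R 1 (qmod R ω (Ideal.span {x})) (ModuleCat.of R ω),
      Function.Surjective g ∧
        Function.Exact (LinearMap.toSpanSingleton R ω ⟨x, hxω⟩) g := by
  have hS := exactComplex_shortExact (toSpanSingleton_injective hxω hxreg)
    (Submodule.mkQ_surjective _) (exact_toSpanSingleton_mkQ hxω)
  let e : ω ≃ₗ[R] Abelian.Ext (ModuleCat.of R R) (ModuleCat.of R ω) 0 :=
    (LinearMap.ringLmapEquivSelf R R ω).symm.trans
      ((ModuleCat.homLinearEquiv (S := R)
        (M := ModuleCat.of R R) (N := ModuleCat.of R ω)).symm.trans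
      (Abelian.Ext.linearEquiv₀ (R := R)).symm)
  have he (w : ω) : e w = Abelian.Ext.mk₀ (ModuleCat.ofHom (LinearMap.toSpanSingleton R ω w)) := by
    refine congrArg (fun t => Abelian.Ext.mk₀ (ModuleCat.ofHom t))
      (LinearMap.ext_ring (f := (LinearMap.ringLmapEquivSelf R R ω).symm w) ?_)
    simp
  let δ := hS.extClass.precompOfLinear R (ModuleCat.of R ω) (add_comm 1 0)
  let c := modExtEquiv 1 (qmod R ω (Ideal.span {x})) (ModuleCat.of R ω)
  refine ⟨c.symm.toLinearMap ∘ₗ δ ∘ₗ e.toLinearMap, fun a => ?_, fun w => ?_⟩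
  · obtain ⟨b, hb⟩ := Abelian.Ext.contravariant_sequence_exact₃ hS (ModuleCat.of R ω) (c a)
      (hω.elim _ _) (add_comm 1 0)
    obtain ⟨w, rfl⟩ := e.surjective b
    exact ⟨w, (congrArg c.symm hb).trans (c.symm_apply_apply a)⟩
  · have hδ : (c.symm.toLinearMap ∘ₗ δ ∘ₗ e.toLinearMap) w = 0 ↔
        hS.extClass.comp (e w) (add_comm 1 0) = 0 :=
      c.symm.map_eq_zero_iff
    rw [hδ, he]
    constructor
    · intro h
      obtain ⟨b, hb⟩ := Abelian.Ext.contravariant_sequence_exact₁ hS _ _ _ h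
      obtain ⟨s, rfl⟩ := (Abelian.Ext.mk₀_bijective _ _).2 b
      rw [Abelian.Ext.mk₀_comp_mk₀] at hb
      obtain ⟨r, hr⟩ := hend s.hom
      have h1 := congrArg (fun t => t.hom (1 : R)) ((Abelian.Ext.mk₀_bijective _ _).1 hb)
      refine ⟨r, ?_⟩
      have hw : s.hom ((1 : R) • ⟨x, hxω⟩) = (1 : R) • w := h1
      rw [hr, one_smul, one_smul] at hw
      exact hw
    · rintro ⟨r, rfl⟩
      have : ModuleCat.ofHom (LinearMap.toSpanSingleton R ω (r • ⟨x, hxω⟩)) =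
          (exactComplex (exact_toSpanSingleton_mkQ hxω)).f ≫
            ModuleCat.ofHom (r • LinearMap.id) := by
        ext
        exact congrArg Subtype.val (smul_comm (1 : R) r (⟨x, hxω⟩ : ω))
      rw [LinearMap.toSpanSingleton_apply, this, ← Abelian.Ext.mk₀_comp_mk₀]
      exact hS.extClass_comp_assoc _

end Retract

section Main

open IsLocalRing

theorem HasFiniteInjDim.exists_extVanishes {Y : ModuleCat.{0} R} (hY : HasFiniteInjDim R Y) :
    ∃ b : ℕ, ∀ n, b < n → ExtVanishesOnFinite R n Y := by
  obtain ⟨b, hb⟩ := hY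
  exact ⟨b, fun n hn L _ _ _ => (extVanishes_iff_modExt n (.of R L) Y).2 (hb _ n hn)⟩

theorem HasFiniteInjDim.congr {Y Z : ModuleCat.{0} R} (hY : HasFiniteInjDim R Y)
    (e : Y ≃ₗ[R] Z) : HasFiniteInjDim R Z := by
  obtain ⟨b, hb⟩ := hY
  exact ⟨b, fun N i hi => (extVanishes_iff_modExt i N Z).1
    (((extVanishes_iff_modExt i N Y).2 (hb N i hi)).congr_right e)⟩

variable [IsLocalRing R]

theorem extVanishes_of_moduleDepth_eq {M : ModuleCat.{0} R} {d : ℕ} (h : moduleDepth R M = d) :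
    (∀ i < d, ExtVanishes R i (ResidueField R) M) ∧ ¬ ExtVanishes R d (ResidueField R) M := by
  constructor
  · intro i hi
    rw [extVanishes_iff_modExt i (.of R (ResidueField R)) M, ← not_nontrivial_iff_subsingleton]
    intro hn
    have hle : moduleDepth R M ≤ i := sInf_le ⟨i, rfl, hn⟩
    rw [h, Nat.cast_le] at hle
    omega
  · rw [extVanishes_iff_modExt d (.of R (ResidueField R)) M, not_subsingleton_iff_nontrivial]
    have hne : {n : ℕ∞ | ∃ m : ℕ, n = (m : ℕ∞) ∧
        Nontrivial (ModExt R m (ModuleCat.of R (ResidueField R)) M)}.Nonempty := by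
      by_contra hempty
      rw [moduleDepth, Set.not_nonempty_iff_eq_empty.1 hempty, sInf_empty] at h
      exact ENat.top_ne_natCast d h
    obtain ⟨m, hm, hn⟩ := csInf_mem hne
    rw [show d = m from Nat.cast_injective (h.symm.trans hm)]
    exact hn

/-- In a minimal MCM approximation of a module `M` with `Ext^1(M, Y) = 0`, the kernel `Y`
vanishes. -/
theorem bijective_of_isMinMCMApprox {M Y X : ModuleCat.{0} R} {ι : Y →ₗ[R] X} {π : X →ₗ[R] M}
    (h : IsMinMCMApprox R M Y X ι π) (hM : ExtVanishes R 1 M Y) : Function.Bijective π := by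
  obtain ⟨⟨-, -, -, -, hι, hπ, hex⟩, hmin⟩ := h
  refine ⟨?_, hπ⟩
  rw [injective_iff_map_eq_zero]
  intro z hz
  obtain ⟨y, rfl⟩ := (hex z).1 hz
  obtain ⟨σ, hσ⟩ := exists_lift hι hπ hex hM LinearMap.id
  obtain ⟨e, he, -⟩ := hex.splitSurjectiveEquiv hι ⟨σ, hσ⟩
  rcases subsingleton_or_nontrivial Y with hY | hY
  · rw [Subsingleton.elim y 0, map_zero]
  · refine absurd ⟨Y, .of R PUnit, M, hY, LinearEquiv.prodUnique.symm, e, 0, fun y => ?_⟩ hmin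
    rw [he]
    simp

omit [IsLocalRing R] in
theorem wRank_eq_zero_of_not_retract {W X : ModuleCat.{0} R}
    (h : ∀ (i : W →ₗ[R] X) (q : X →ₗ[R] W), q ∘ₗ i ≠ LinearMap.id) : wRank R W X = 0 := by
  refine le_antisymm (sSup_le ?_) zero_le
  rintro _ ⟨m, rfl, X', ⟨e⟩⟩
  cases m with
  | zero => exact le_rfl
  | succ m =>
    refine absurd ?_ (h (e.symm.toLinearMap ∘ₗ LinearMap.inl R _ _ ∘ₗ LinearMap.single R (fun _ : Fin (m + 1) => W) 0)
      (LinearMap.proj 0 ∘ₗ LinearMap.fst R _ _ ∘ₗ e.toLinearMap))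
    ext w
    simp

variable [IsNoetherianRing R]

theorem exists_isWeaklyRegular_of_extVanishes {W : Type} [AddCommGroup W] [Module R W]
    [Module.Finite R W] [Nontrivial W] {d : ℕ}
    (h : ∀ i < d, ExtVanishes R i (ResidueField R) W) :
    ∃ rs : List R, rs.length = d ∧ (∀ r ∈ rs, r ∈ maximalIdeal R) ∧
      RingTheory.Sequence.IsWeaklyRegular W rs := by
  obtain ⟨rs, hlen, hmem, hreg⟩ := ModuleCat.exists_isRegular_of_exists_subsingleton_ext
    (maximalIdeal R) d (.of R W) (lt_top_iff_ne_top.2 (Ne.symm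
      (Submodule.top_ne_ideal_smul_of_le_jacobson_annihilator (maximalIdeal_le_jacobson _))))
    (.of R (ResidueField R))
    (by rw [Module.support_eq_zeroLocus]; exact congrArg _ (by rw [annihilator_residueField])) h
  exact ⟨rs, hlen, hmem, hreg.toIsWeaklyRegular⟩

variable {ω : Ideal R} {x : R}

theorem isGorensteinLocalRing_of_retract {E : Type} [AddCommGroup E] [Module R E]
    {g : ω →ₗ[R] E} (hinj : HasFiniteInjDim R (ModuleCat.of R ω)) (hxω : x ∈ ω)
    (hxreg : x ∈ nonZeroDivisors R) (hg : Function.Surjective g)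
    (hex : Function.Exact (LinearMap.toSpanSingleton R ω ⟨x, hxω⟩) g)
    (hω : ExtVanishes R 1 ω ω) {n : ℕ} {p : (Fin n → R) →ₗ[R] E}
    (hp : Function.Surjective p) (i : ω →ₗ[R] LinearMap.ker p) (q : LinearMap.ker p →ₗ[R] ω)
    (hqi : q ∘ₗ i = LinearMap.id) : IsGorensteinLocalRing R := by
  obtain ⟨u, q', h⟩ := exists_free_retract hxreg hxω hg hex hω hp i q hqi
  obtain ⟨e⟩ := nonempty_linearEquiv_of_retract hxω hxreg u q' h
  exact ⟨inferInstance, inferInstance, hinj.congr (Z := .of R R) e⟩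

/-- The `ω`-rank of the MCM approximation of a syzygy of a quotient of `ω` by `xR` vanishes. -/
theorem wRank_eq_zero_of_syzygy {E : Type} [AddCommGroup E] [Module R E]
    {g : ω →ₗ[R] E} (hnG : ¬ IsGorensteinLocalRing R)
    (hinj : HasFiniteInjDim R (ModuleCat.of R ω))
    (hext : ∀ Y : ModuleCat.{0} R, Module.Finite R Y → HasFiniteInjDim R Y →
      ∀ i, ExtVanishes R (i + 1) ω Y) (hxω : x ∈ ω)
    (hxreg : x ∈ nonZeroDivisors R) (hg : Function.Surjective g)
    (hex : Function.Exact (LinearMap.toSpanSingleton R ω ⟨x, hxω⟩) g)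
    {n : ℕ} {p : (Fin n → R) →ₗ[R] E} (hp : Function.Surjective p) {Y X : ModuleCat.{0} R}
    {ι : Y →ₗ[R] X} {π : X →ₗ[R] ModuleCat.of R (LinearMap.ker p)}
    (h : IsMinMCMApprox R (ModuleCat.of R (LinearMap.ker p)) Y X ι π) :
    wRank R (ModuleCat.of R ω) X = 0 := by
  have hE : ExtVanishes R 2 E Y :=
    (ExtVanishes.of_free 0).contra_right (toSpanSingleton_injective hxω hxreg) hg hex
      (hext Y h.1.2.1 h.1.2.2.2.1 1)
  have hM : ExtVanishes R 1 (LinearMap.ker p) Y :=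
    (ExtVanishes.of_free 0).contra_left (LinearMap.ker p).injective_subtype hp
      (LinearMap.exact_subtype_ker_map p) hE
  let e : X ≃ₗ[R] LinearMap.ker p := LinearEquiv.ofBijective π (bijective_of_isMinMCMApprox h hM)
  refine wRank_eq_zero_of_not_retract fun i q hqi => hnG ?_
  refine isGorensteinLocalRing_of_retract hinj hxω hxreg hg hex
    (hext (.of R ω) inferInstance hinj 0) hp (e.toLinearMap ∘ₗ i) (q ∘ₗ e.symm.toLinearMap) ?_
  rw [← hqi]
  ext1 w
  simp

/-- Vanishing of `Ext` out of a canonical module of a Cohen-Macaulay ring, and out of its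
endomorphism ring. -/
theorem IsCanonicalIdeal.extVanishes (hCM : IsCMLocalRing R) (hω : IsCanonicalIdeal R ω)
    [Nontrivial ω] :
    ∃ d : ℕ, ¬ ExtVanishes R d (ResidueField R) ω ∧ ExtVanishesOnFinite R (d + 1) ω ∧
      (∀ Y : ModuleCat.{0} R, Module.Finite R Y → HasFiniteInjDim R Y →
        ∀ i, ExtVanishes R (i + 1) ω Y) ∧
      ∀ i, ExtVanishes R (i + 1) (ω →ₗ[R] ω) ω := by
  obtain ⟨-, hinj, d, hd, ⟨e⟩, hne⟩ := hω
  have hdepth : moduleDepth R (ModuleCat.of R R) = d := by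
    have := hCM.2.trans hd
    exact_mod_cast this
  obtain ⟨hlt, hdR⟩ := extVanishes_of_moduleDepth_eq hdepth
  have hbound (Y : ModuleCat.{0} R) (hY : Module.Finite R Y) (hYinj : HasFiniteInjDim R Y) :
      ∀ n, d < n → ExtVanishesOnFinite R n Y := by
    obtain ⟨b, hb⟩ := hYinj.exists_extVanishes
    exact extVanishesOnFinite_of_depth hlt hdR hb
  obtain ⟨rs, hlen, hmem, hreg⟩ := exists_isWeaklyRegular_of_extVanishes (W := ω) fun i hi =>
    (extVanishes_iff_modExt i (.of R (ResidueField R)) (.of R ω)).2 (hne i hi.ne)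
  have hext (Y : ModuleCat.{0} R) (hY : Module.Finite R Y) (hYinj : HasFiniteInjDim R Y) (i : ℕ) :
      ExtVanishes R (i + 1) ω Y :=
    extVanishes_of_isWeaklyRegular (hbound Y hY hYinj) rs ω (i + 1) hmem hreg (by omega)
  have hωω := hbound (.of R ω) inferInstance hinj
  refine ⟨d, ?_, hωω (d + 1) (by omega), hext, fun i => ?_⟩
  · rw [extVanishes_iff_modExt d (.of R (ResidueField R)) (.of R ω),
      not_subsingleton_iff_nontrivial]
    exact e.toEquiv.nontrivial
  · exact extVanishes_of_isWeaklyRegular hωω rs _ (i + 1) hmem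
      (isWeaklyRegular_linearMap rs _ hreg (hext (.of R ω) inferInstance hinj)) (by omega)

end Main

end Auxiliary

theorem stmt3 (R : Type) [CommRing R] [IsLocalRing R]
    (hCM : IsCMLocalRing R) (hGG : IsGenericallyGorenstein R)
    (hnG : ¬ IsGorensteinLocalRing R)
    (ω : Ideal R) (hω : IsCanonicalIdeal R ω)
    (x : R) (hxω : x ∈ ω) (hxreg : x ∈ nonZeroDivisors R) :
    (∀ (n : ℕ) (p : (Fin n → R) →ₗ[R] qmod R ω (Ideal.span {x})), Function.Surjective p →
        LinearMap.ker p ≤ (IsLocalRing.maximalIdeal R) • (⊤ : Submodule R (Fin n → R)) →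
        ∀ (Y X : ModuleCat R) (ι : Y →ₗ[R] X)
          (π : X →ₗ[R] ModuleCat.of R ↥(LinearMap.ker p)),
          IsMinMCMApprox R (ModuleCat.of R ↥(LinearMap.ker p)) Y X ι π →
          wRank R (ModuleCat.of R ↥ω) X = 0) ∧
    (∀ (n : ℕ) (p : (Fin n → R) →ₗ[R] ModExt R 1 (qmod R ω (Ideal.span {x})) (ModuleCat.of R ↥ω)), Function.Surjective p →
        LinearMap.ker p ≤ (IsLocalRing.maximalIdeal R) • (⊤ : Submodule R (Fin n → R)) →
        ∀ (Y X : ModuleCat R) (ι : Y →ₗ[R] X)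
          (π : X →ₗ[R] ModuleCat.of R ↥(LinearMap.ker p)),
          IsMinMCMApprox R (ModuleCat.of R ↥(LinearMap.ker p)) Y X ι π →
          wRank R (ModuleCat.of R ↥ω) X = 0) := by
  have := hCM.1
  have : Nontrivial ω := ⟨⟨x, hxω⟩, 0, fun h =>
    nonZeroDivisors.ne_zero hxreg (congrArg Subtype.val h)⟩
  obtain ⟨d, hd, hωd, hext, hEnd⟩ := hω.extVanishes hCM
  obtain ⟨g, hg, hex⟩ := exists_surjective_ext_one hxω hxreg
    (hext (.of R ω) inferInstance hω.2.1 0) (exists_eq_smul_of_end hxω hxreg hd hωd hEnd)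
  exact ⟨fun n p hp _ Y X ι π h => wRank_eq_zero_of_syzygy hnG hω.2.1 hext hxω hxreg
      (Submodule.mkQ_surjective _) (exact_toSpanSingleton_mkQ hxω) hp h,
    fun n p hp _ Y X ι π h => wRank_eq_zero_of_syzygy hnG hω.2.1 hext hxω hxreg hg hex hp h⟩

end
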